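/- The five polynomial equations α₁δ₁₁₁+γ₁₁²=0, α₁δ₁₁₂+α₂δ₁₁₁+2γ₁₁γ₁₂=0, α₁δ₁₂₂+α₂δ₁₁₂+2γ₁₁γ₂₂+γ₁₂²=0, α₁δ₂₂₂+α₂δ₁₂₂+2γ₁₂γ₂₂=0, α₂δ₂₂₂+γ₂₂²=0 define a subvariety of codimension 5 in the affine space of coefficient tuples (α₁,α₂,γ₁₁,γ₁₂,γ₂₂,δ₁₁₁,δ₁₁₂,δ₁₂₂,δ₂₂₂); i.e., these five conditions are independent. -/

import Mathlib

open MvPolynomial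

/-- Incomparability: an integral extension does not raise the Krull dimension. -/
lemma aux_dim_le_of_integral {B A : Type} [CommRing B] [CommRing A] (g : B →+* A)
    (hg : g.IsIntegral) : ringKrullDim A ≤ ringKrullDim B := by
  algebraize [g]
  refine Order.krullDim_le_of_strictMono (PrimeSpectrum.comap (algebraMap B A)) ?_
  intro p q hpq
  have hpq' : p.asIdeal < q.asIdeal := hpq
  exact Ideal.IsIntegral.comap_lt_comap hpq'

/-- A finitely generated domain has Krull dimension at most its transcendence degree. -/
lemma aux_dim_le_of_trdeg {k A : Type} [Field k] [CommRing A] [IsDomain A] [Algebra k A]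
    [Algebra.FiniteType k A] (n : ℕ) (h : Algebra.trdeg k A ≤ n) :
    ringKrullDim A ≤ n := by
  obtain ⟨s, g, hinj, hint⟩ := exists_integral_inj_algHom_of_fg k A
  have h1 := aux_dim_le_of_integral g.toRingHom hint
  have h2 := lift_trdeg_le_of_injective g hinj
  rw [MvPolynomial.trdeg_of_isDomain] at h2
  simp only [Cardinal.mk_fin, Cardinal.lift_id] at h2
  have h3 : s ≤ n := by exact_mod_cast h2.trans h
  rw [MvPolynomial.ringKrullDim_of_isNoetherianRing, ringKrullDim_eq_zero_of_field] at h1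
  simp only [zero_add, Nat.card_eq_fintype_card, Fintype.card_fin] at h1
  exact h1.trans (by exact_mod_cast h3)

/-- If the nine generators are algebraic over four elements, the dimension is at most `4`. -/
lemma aux_dim_le_of_alg {k A : Type} [Field k] [CommRing A] [IsDomain A] [Algebra k A]
    (a : Fin 9 → A) (hgen : Algebra.adjoin k (Set.range a) = ⊤)
    (x y z w : A)
    (H : ∀ i, IsAlgebraic (Algebra.adjoin k ({x, y, z, w} : Set A)) (a i)) :
    ringKrullDim A ≤ 4 := by
  classical
  have : Algebra.FiniteType k A :=
    ⟨⟨Finset.univ.image a, by simpa using hgen⟩⟩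
  refine aux_dim_le_of_trdeg (k := k) 4 ?_
  have halg : Algebra.IsAlgebraic (Algebra.adjoin k ({x, y, z, w} : Set A)) A := by
    refine ⟨fun b => ?_⟩
    have hb : b ∈ Algebra.adjoin k (Set.range a) := by rw [hgen]; trivial
    have hle : Algebra.adjoin k (Set.range a) ≤ (Subalgebra.algebraicClosure
        (Algebra.adjoin k ({x, y, z, w} : Set A)) A).restrictScalars k := by
      refine Algebra.adjoin_le ?_
      rintro _ ⟨i, rfl⟩
      exact H i
    exact hle hb
  refine (Algebra.IsAlgebraic.trdeg_le_cardinalMk k ({x, y, z, w} : Set A)).trans ?_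
  have h4 : (({x, y, z, w} : Finset A) : Set A) = {x, y, z, w} := by simp
  rw [← h4]
  simp only [Finset.coe_sort_coe, Cardinal.mk_coe_finset]
  exact_mod_cast Finset.card_le_four

/-- The main geometric input: a domain generated by nine elements satisfying the relations. -/
lemma aux_main {k A : Type} [Field k] [CommRing A] [IsDomain A] [Algebra k A]
    (a : Fin 9 → A) (hgen : Algebra.adjoin k (Set.range a) = ⊤)
    (e1 : a 0 * a 5 + a 2 ^ 2 = 0)
    (e2 : a 0 * a 6 + a 1 * a 5 + 2 * a 2 * a 3 = 0)
    (e3 : a 0 * a 7 + a 1 * a 6 + 2 * a 2 * a 4 + a 3 ^ 2 = 0)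
    (e4 : a 0 * a 8 + a 1 * a 7 + 2 * a 3 * a 4 = 0)
    (e5 : a 1 * a 8 + a 4 ^ 2 = 0) :
    ringKrullDim A ≤ 4 := by
  have key : a 0 ^ 2 * a 4 - a 0 * a 1 * a 3 + a 1 ^ 2 * a 2 = 0 := by
    refine pow_eq_zero_iff (two_ne_zero) |>.mp ?_
    linear_combination a 1 ^ 4 * e1 - a 1 ^ 3 * a 0 * e2 + a 1 ^ 2 * a 0 ^ 2 * e3
      - a 1 * a 0 ^ 3 * e4 + a 0 ^ 4 * e5
  by_cases h0 : a 0 = 0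
  · by_cases h1 : a 1 = 0
    · have h2 : a 2 = 0 := by simpa [h0] using e1
      have h4 : a 4 = 0 := by simpa [h1] using e5
      have h3 : a 3 = 0 := by simpa [h0, h1, h2] using e3
      refine aux_dim_le_of_alg a hgen (a 5) (a 6) (a 7) (a 8) ?_
      set S := Algebra.adjoin k ({a 5, a 6, a 7, a 8} : Set A) with hS
      have hin : ∀ b ∈ ({a 5, a 6, a 7, a 8} : Set A), IsAlgebraic S b := fun b hb =>
        isAlgebraic_algebraMap (⟨b, Algebra.subset_adjoin hb⟩ : S)
      have hz : IsAlgebraic S (0 : A) := isAlgebraic_zero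
      intro i
      fin_cases i
      · simpa [h0] using hz
      · simpa [h1] using hz
      · simpa [h2] using hz
      · simpa [h3] using hz
      · simpa [h4] using hz
      all_goals exact hin _ (by simp)
    · refine aux_dim_le_of_alg a hgen (a 0) (a 1) (a 3) (a 4) ?_
      set S := Algebra.adjoin k ({a 0, a 1, a 3, a 4} : Set A) with hS
      have hin : ∀ b ∈ ({a 0, a 1, a 3, a 4} : Set A),
          b ∈ Subalgebra.algebraicClosure S A := fun b hb =>
        isAlgebraic_algebraMap (⟨b, Algebra.subset_adjoin hb⟩ : S)
      have hdiv : ∀ b : A, a 1 * b ∈ Subalgebra.algebraicClosure S A →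
          b ∈ Subalgebra.algebraicClosure S A := fun b hb =>
        IsAlgebraic.of_mul (mem_nonZeroDivisors_of_ne_zero h1) (hin _ (by simp)) hb
      change ∀ i, a i ∈ Subalgebra.algebraicClosure S A
      generalize Subalgebra.algebraicClosure S A = C at hin hdiv
      have m0 : a 0 ∈ C := hin _ (by simp)
      have m1 : a 1 ∈ C := hin _ (by simp)
      have m3 : a 3 ∈ C := hin _ (by simp)
      have m4 : a 4 ∈ C := hin _ (by simp)
      have two : (2 : A) ∈ C := ofNat_mem C 2
      have m2 : a 2 ∈ C := by
        refine hdiv _ (hdiv _ ?_)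
        have : a 1 * (a 1 * a 2) = 0 := by
          linear_combination key - (a 0 * a 4 - a 1 * a 3) * h0
        rw [this]; exact C.zero_mem
      have m5 : a 5 ∈ C := by
        refine hdiv _ ?_
        have : a 1 * a 5 = -(2 * a 2 * a 3) := by
          linear_combination e2 - a 6 * h0
        rw [this]; exact C.neg_mem (C.mul_mem (C.mul_mem two m2) m3)
      have m6 : a 6 ∈ C := by
        refine hdiv _ ?_
        have : a 1 * a 6 = -(2 * a 2 * a 4 + a 3 ^ 2) := by
          linear_combination e3 - a 7 * h0
        rw [this]
        exact C.neg_mem (C.add_mem (C.mul_mem (C.mul_mem two m2) m4) (C.pow_mem m3 2))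
      have m7 : a 7 ∈ C := by
        refine hdiv _ ?_
        have : a 1 * a 7 = -(2 * a 3 * a 4) := by
          linear_combination e4 - a 8 * h0
        rw [this]; exact C.neg_mem (C.mul_mem (C.mul_mem two m3) m4)
      have m8 : a 8 ∈ C := by
        refine hdiv _ ?_
        have : a 1 * a 8 = -(a 4 ^ 2) := by linear_combination e5
        rw [this]; exact C.neg_mem (C.pow_mem m4 2)
      intro i
      fin_cases i <;> assumption
  · refine aux_dim_le_of_alg a hgen (a 0) (a 1) (a 2) (a 3) ?_
    set S := Algebra.adjoin k ({a 0, a 1, a 2, a 3} : Set A) with hS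
    have hin : ∀ b ∈ ({a 0, a 1, a 2, a 3} : Set A),
        b ∈ Subalgebra.algebraicClosure S A := fun b hb =>
      isAlgebraic_algebraMap (⟨b, Algebra.subset_adjoin hb⟩ : S)
    have hdiv : ∀ b : A, a 0 * b ∈ Subalgebra.algebraicClosure S A →
        b ∈ Subalgebra.algebraicClosure S A := fun b hb =>
      IsAlgebraic.of_mul (mem_nonZeroDivisors_of_ne_zero h0) (hin _ (by simp)) hb
    change ∀ i, a i ∈ Subalgebra.algebraicClosure S A
    generalize Subalgebra.algebraicClosure S A = C at hin hdiv
    have m0 : a 0 ∈ C := hin _ (by simp)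
    have m1 : a 1 ∈ C := hin _ (by simp)
    have m2 : a 2 ∈ C := hin _ (by simp)
    have m3 : a 3 ∈ C := hin _ (by simp)
    have two : (2 : A) ∈ C := ofNat_mem C 2
    have m4 : a 4 ∈ C := by
      refine hdiv _ (hdiv _ ?_)
      have : a 0 * (a 0 * a 4) = a 0 * a 1 * a 3 - a 1 ^ 2 * a 2 := by
        linear_combination key
      rw [this]
      exact C.sub_mem (C.mul_mem (C.mul_mem m0 m1) m3) (C.mul_mem (C.pow_mem m1 2) m2)
    have m5 : a 5 ∈ C := by
      refine hdiv _ ?_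
      have : a 0 * a 5 = -(a 2 ^ 2) := by linear_combination e1
      rw [this]; exact C.neg_mem (C.pow_mem m2 2)
    have m6 : a 6 ∈ C := by
      refine hdiv _ ?_
      have : a 0 * a 6 = -(a 1 * a 5 + 2 * a 2 * a 3) := by linear_combination e2
      rw [this]
      exact C.neg_mem (C.add_mem (C.mul_mem m1 m5) (C.mul_mem (C.mul_mem two m2) m3))
    have m7 : a 7 ∈ C := by
      refine hdiv _ ?_
      have : a 0 * a 7 = -(a 1 * a 6 + 2 * a 2 * a 4 + a 3 ^ 2) := by
        linear_combination e3
      rw [this]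
      exact C.neg_mem (C.add_mem (C.add_mem (C.mul_mem m1 m6)
        (C.mul_mem (C.mul_mem two m2) m4)) (C.pow_mem m3 2))
    have m8 : a 8 ∈ C := by
      refine hdiv _ ?_
      have : a 0 * a 8 = -(a 1 * a 7 + 2 * a 3 * a 4) := by linear_combination e4
      rw [this]
      exact C.neg_mem (C.add_mem (C.mul_mem m1 m7) (C.mul_mem (C.mul_mem two m3) m4))
    intro i
    fin_cases i <;> assumption

/-- The Krull dimension is bounded by those of the quotients by primes. -/
lemma aux_dim_le_of_prime_quotients {Q : Type} [CommRing Q] (n : ℕ)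
    (h : ∀ p : Ideal Q, p.IsPrime → ringKrullDim (Q ⧸ p) ≤ n) : ringKrullDim Q ≤ n := by
  rw [ringKrullDim, Order.krullDim_eq_iSup_coheight]
  refine iSup_le fun p => ?_
  rw [Order.coheight_eq_krullDim_Ici]
  have := h p.asIdeal p.isPrime
  rw [ringKrullDim_quotient] at this
  have he : PrimeSpectrum.zeroLocus (R := Q) p.asIdeal = Set.Ici p := by
    ext q
    rfl
  rwa [he] at this

/-- The upper bound, for any ideal containing the five relations. -/
lemma aux_upper {k : Type} [Field k] (I : Ideal (MvPolynomial (Fin 9) k))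
    (e1 : X 0 * X 5 + X 2 ^ 2 ∈ I)
    (e2 : X 0 * X 6 + X 1 * X 5 + 2 * X 2 * X 3 ∈ I)
    (e3 : X 0 * X 7 + X 1 * X 6 + 2 * X 2 * X 4 + X 3 ^ 2 ∈ I)
    (e4 : X 0 * X 8 + X 1 * X 7 + 2 * X 3 * X 4 ∈ I)
    (e5 : X 1 * X 8 + X 4 ^ 2 ∈ I) :
    ringKrullDim (MvPolynomial (Fin 9) k ⧸ I) ≤ 4 := by
  refine aux_dim_le_of_prime_quotients 4 fun p hp => ?_
  let f : MvPolynomial (Fin 9) k →ₐ[k] ((MvPolynomial (Fin 9) k ⧸ I) ⧸ p) :=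
    (Ideal.Quotient.mkₐ k p).comp (Ideal.Quotient.mkₐ k I)
  have hf : Function.Surjective f :=
    (Ideal.Quotient.mkₐ_surjective k p).comp (Ideal.Quotient.mkₐ_surjective k I)
  have hI : ∀ q ∈ I, f q = 0 := by
    intro q hq
    have h0 : Ideal.Quotient.mkₐ k I q = 0 := Ideal.Quotient.eq_zero_iff_mem.mpr hq
    simp only [f, AlgHom.comp_apply, h0, map_zero]
  have h2 : f 2 = 2 := map_ofNat f 2
  refine aux_main (k := k) (fun i => f (X i)) ?_ ?_ ?_ ?_ ?_ ?_
  · have hr : Set.range (fun i => f (X i)) = f '' Set.range (X : Fin 9 → _) := by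
      rw [← Set.range_comp]; rfl
    rw [hr, ← AlgHom.map_adjoin, MvPolynomial.adjoin_range_X, Algebra.map_top]
    exact (AlgHom.range_eq_top f).mpr hf
  · simpa using hI _ e1
  · simpa [h2] using hI _ e2
  · simpa [h2] using hI _ e3
  · simpa [h2] using hI _ e4
  · simpa using hI _ e5

/-- The lower bound: the linear space `α = γ = 0` lies in the variety. -/
lemma aux_lower {k : Type} [Field k] (I : Ideal (MvPolynomial (Fin 9) k))
    (hI : ∀ q ∈ I, aeval (R := k)
      (![0, 0, 0, 0, 0, X 0, X 1, X 2, X 3] : Fin 9 → MvPolynomial (Fin 4) k) q = 0) :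
    4 ≤ ringKrullDim (MvPolynomial (Fin 9) k ⧸ I) := by
  have h4 : ringKrullDim (MvPolynomial (Fin 4) k) = 4 := by
    rw [MvPolynomial.ringKrullDim_of_isNoetherianRing, ringKrullDim_eq_zero_of_field]
    simp
  rw [← h4]
  let φ : MvPolynomial (Fin 9) k →ₐ[k] MvPolynomial (Fin 4) k :=
    aeval (![0, 0, 0, 0, 0, X 0, X 1, X 2, X 3] : Fin 9 → MvPolynomial (Fin 4) k)
  refine ringKrullDim_le_of_surjective (Ideal.Quotient.lift I φ.toRingHom hI) ?_
  refine Ideal.Quotient.lift_surjective_of_surjective I hI ?_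
  have hs : φ.range = ⊤ := by
    rw [eq_top_iff, ← MvPolynomial.adjoin_range_X]
    refine Algebra.adjoin_le ?_
    rintro _ ⟨i, rfl⟩
    fin_cases i
    · exact ⟨X 5, by simp [φ]⟩
    · exact ⟨X 6, by simp [φ]⟩
    · exact ⟨X 7, by simp [φ]⟩
    · exact ⟨X 8, by simp [φ]⟩
  exact (AlgHom.range_eq_top φ).mp hs

/-- The five equations `α₁δ₁₁₁+γ₁₁²=0`, `α₁δ₁₁₂+α₂δ₁₁₁+2γ₁₁γ₁₂=0`,
`α₁δ₁₂₂+α₂δ₁₁₂+2γ₁₁γ₂₂+γ₁₂²=0`, `α₁δ₂₂₂+α₂δ₁₂₂+2γ₁₂γ₂₂=0`, `α₂δ₂₂₂+γ₂₂²=0`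
cut out a codimension `5` subvariety of the affine space `𝔸⁹` with coordinates
`α₁,α₂,γ₁₁,γ₁₂,γ₂₂,δ₁₁₁,δ₁₁₂,δ₁₂₂,δ₂₂₂` (indexed `0,…,8`); i.e. the quotient of
the polynomial ring in `9` variables by these five relations has Krull
dimension `9 - 5 = 4`. -/
theorem stmt_1 {k : Type} [Field k] [IsAlgClosed k] [CharZero k] :
    ringKrullDim (MvPolynomial (Fin 9) k ⧸ (Ideal.span
      ({ X 0 * X 5 + X 2 ^ 2,
         X 0 * X 6 + X 1 * X 5 + 2 * X 2 * X 3,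
         X 0 * X 7 + X 1 * X 6 + 2 * X 2 * X 4 + X 3 ^ 2,
         X 0 * X 8 + X 1 * X 7 + 2 * X 3 * X 4,
         X 1 * X 8 + X 4 ^ 2 } : Set (MvPolynomial (Fin 9) k)))) = 4 := by
  refine le_antisymm (aux_upper _ ?_ ?_ ?_ ?_ ?_) (aux_lower _ ?_)
  · exact Ideal.subset_span (by simp)
  · exact Ideal.subset_span (by simp)
  · exact Ideal.subset_span (by simp)
  · exact Ideal.subset_span (by simp)
  · exact Ideal.subset_span (by simp)
  · intro q hq
    refine (RingHom.mem_ker).mp ((Ideal.span_le.mpr ?_) hq)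
    rintro _ (rfl | rfl | rfl | rfl | rfl) <;> simp
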